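/- arXiv:1711.02603 — 2 statements merged into one kernel-verified Lean document; each statement's English description precedes it below -/
import Mathlib

section
/- Let t ∈ ℝ and m ∈ ℕ. Define C(m,n,k) = n!·(m!)^k · Σ_{j_1 + ⋯ + j_k = n, j_i ≥ 0} 1/((m+j_1)!⋯(m+j_k)!). Then there exists r > 0 such that for every real z with 0 < |z| ≤ r, the number (z^m/m!)/(e^z − Σ_{k=0}^{m−1} z^k/k!) is positive and ((z^m/m!)/(e^z − Σ_{k=0}^{m−1} z^k/k!))^t = Σ_{n=0}^∞ (z^n/n!) · Σ_{k=0}^n C(−t,k)·C(n+t, n−k)·C(m,n,k), the series converging absolutely, where for real s, C(s,k) = s(s−1)⋯(s−k+1)/k!. -/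
open Real Finset

/-- Generalized binomial coefficient `C(s, k) = s(s-1)⋯(s-k+1)/k!` for real `s`. -/
noncomputable def genBinom (s : ℝ) (k : ℕ) : ℝ :=
  (∏ i ∈ Finset.range k, (s - (i : ℝ))) / (Nat.factorial k : ℝ)

theorem genBinom_eq_choose (s : ℝ) (k : ℕ) : genBinom s k = Ring.choose s k := by
  rw [Ring.choose_eq_smul, genBinom, ← descPochhammer_eval_eq_prod_range,
    ← descPochhammer_map (Int.castRingHom ℝ), Polynomial.eval_map, div_eq_inv_mul, smul_eq_mul,
    ← Polynomial.eval₂_smulOneHom_eq_smeval]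
  congr 2
  exact RingHom.ext_int _ _

theorem sum_choose_mul_choose_mul_neg_one_pow (s : ℝ) {k n : ℕ} (h : k ≤ n) :
    ∑ l ∈ range (n + 1), Ring.choose s l * ((-1) ^ (l - k) * (l.choose k : ℝ)) =
      Ring.choose s k * Ring.choose (n - s) (n - k) := by
  induction n, h using Nat.le_induction with
  | base =>
    rw [sum_eq_single k]
    · simp
    · intro l hl hlk
      have : l < k := by grind
      simp [Nat.choose_eq_zero_of_lt this]
    · simp
  | succ n hkn ih =>
    rw [sum_range_succ, ih]
    obtain ⟨j, rfl⟩ := Nat.exists_eq_add_of_le hkn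
    have h1 := Ring.choose_smul_choose s (show k ≤ k + j + 1 by omega)
    have h2 := Ring.choose_neg ((k + j : ℕ) - s - j : ℝ) (j + 1)
    have h3 := Ring.choose_succ_succ ((k + j : ℕ) - s : ℝ) j
    have e1 : k + j + 1 - k = j + 1 := by omega
    have e2 : k + j - k = j := by omega
    rw [e1] at h1 ⊢
    rw [e2]
    rw [Int.negOnePow_def, zpow_natCast, Units.smul_def, zsmul_eq_mul] at h2
    push_cast at h1 h2 h3 ⊢
    rw [show (-(k + j - s - j) : ℝ) = s - k by ring,
      show (k + j - s - j + (j + 1) - 1 : ℝ) = k + j - s by ring] at h2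
    rw [show (k + j + 1 - s : ℝ) = k + j - s + 1 by ring, h3]
    rw [h2, nsmul_eq_mul] at h1
    have h4 : ((-1 : ℝ) ^ (j + 1)) * (-1) ^ (j + 1) = 1 := by
      rw [← mul_pow]; simp
    linear_combination (-1 : ℝ) ^ (j + 1) * h1 +
      Ring.choose s k * Ring.choose (k + j - s : ℝ) (j + 1) * h4

theorem coeff_sub_one_pow (P : PowerSeries ℝ) (l n : ℕ) {N : ℕ} (h : l ≤ N) :
    ((P - 1) ^ l).coeff n =
      ∑ k ∈ range (N + 1), (-1) ^ (l - k) * (l.choose k : ℝ) * (P ^ k).coeff n := by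
  rw [sub_eq_add_neg, add_pow, map_sum]
  rw [← sum_subset (range_mono (show l + 1 ≤ N + 1 by omega))]
  · refine sum_congr rfl fun k _ => ?_
    rw [show P ^ k * (-1) ^ (l - k) * (l.choose k : PowerSeries ℝ) =
      PowerSeries.C ((-1) ^ (l - k) * (l.choose k : ℝ)) * P ^ k by simp; ring,
      PowerSeries.coeff_C_mul]
  · intro k _ hk
    rw [Nat.choose_eq_zero_of_lt (by simpa using hk)]
    simp

theorem sum_choose_mul_coeff_sub_one_pow (s : ℝ) (P : PowerSeries ℝ) (n : ℕ) :
    ∑ l ∈ range (n + 1), Ring.choose s l * ((P - 1) ^ l).coeff n =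
      ∑ k ∈ range (n + 1), Ring.choose s k * Ring.choose (n - s) (n - k) * (P ^ k).coeff n := by
  calc _ = ∑ l ∈ range (n + 1), ∑ k ∈ range (n + 1),
        Ring.choose s l * ((-1) ^ (l - k) * (l.choose k : ℝ)) * (P ^ k).coeff n := by
        refine sum_congr rfl fun l hl => ?_
        rw [coeff_sub_one_pow P l n (Nat.lt_succ_iff.1 (mem_range.1 hl)), mul_sum]
        simp only [mul_assoc]
    _ = _ := by
        rw [sum_comm]
        refine sum_congr rfl fun k hk => ?_
        rw [← sum_mul, sum_choose_mul_choose_mul_neg_one_pow s (Nat.lt_succ_iff.1 (mem_range.1 hk))]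

theorem coeff_mk_pow (f : ℕ → ℝ) (k n : ℕ) :
    ((PowerSeries.mk f) ^ k).coeff n =
      ∑ j ∈ Finset.Nat.antidiagonalTuple k n, ∏ i, f (j i) := by
  have := PowerSeries.coeff_prod (fun _ : Fin k => PowerSeries.mk f) n univ
  simp only [prod_const, card_univ, Fintype.card_fin, PowerSeries.coeff_mk] at this
  rw [this]
  refine sum_bij (fun l _ => l) ?_ ?_ ?_ ?_
  · intro l hl
    simpa [Finset.Nat.mem_antidiagonalTuple] using hl
  · intro a _ b _ h
    exact DFunLike.coe_injective h
  · intro b hb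
    refine ⟨Finsupp.equivFunOnFinite.symm b, ?_, rfl⟩
    simpa [Finset.Nat.mem_antidiagonalTuple] using hb
  · simp

theorem hasSum_coeff_pow (Q : PowerSeries ℝ) (x : ℝ)
    (hQ : Summable fun n => ‖Q.coeff n * x ^ n‖) (l : ℕ) :
    (Summable fun n => ‖(Q ^ l).coeff n * x ^ n‖) ∧
      HasSum (fun n => (Q ^ l).coeff n * x ^ n) ((∑' n, Q.coeff n * x ^ n) ^ l) := by
  induction l with
  | zero =>
    have h : ∀ n, n ∉ ({0} : Finset ℕ) → ((Q ^ 0).coeff n * x ^ n) = 0 := by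
      intro n hn
      simp at hn
      simp [PowerSeries.coeff_one, hn]
    refine ⟨summable_of_ne_finset_zero (s := {0}) fun n hn => by rw [h n hn, norm_zero], ?_⟩
    have := hasSum_sum_of_ne_finset_zero (L := .unconditional ℕ) h
    simpa using this
  | succ l ih =>
    have e : ∀ n, (Q ^ (l + 1)).coeff n * x ^ n =
        ∑ p ∈ antidiagonal n, ((Q ^ l).coeff p.1 * x ^ p.1) * (Q.coeff p.2 * x ^ p.2) := by
      intro n
      rw [pow_succ, PowerSeries.coeff_mul, sum_mul]
      refine sum_congr rfl fun p hp => ?_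
      rw [← mem_antidiagonal.1 hp, pow_add]
      ring
    simp only [e]
    have hs := summable_norm_sum_mul_antidiagonal_of_summable_norm ih.1 hQ
    refine ⟨hs, ?_⟩
    rw [pow_succ, ← ih.2.tsum_eq, tsum_mul_tsum_eq_tsum_sum_antidiagonal_of_summable_norm ih.1 hQ]
    exact hs.of_norm.hasSum

theorem hasSum_choose_mul_pow (s : ℝ) {x : ℝ} (hx : |x| < 1) :
    (Summable fun n => ‖Ring.choose s n * x ^ n‖) ∧
      HasSum (fun n => Ring.choose s n * x ^ n) ((1 + x) ^ s) := by
  have hmem : x ∈ Metric.eball (0 : ℝ) 1 := by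
    simpa [Metric.mem_eball, edist_zero_right, enorm_eq_nnnorm, ← NNReal.coe_lt_coe] using hx
  have h := (Real.one_add_rpow_hasFPowerSeriesOnBall_zero (a := s))
  have h1 := h.hasSum hmem
  have h2 := (binomialSeries ℝ s).summable_norm_apply (Metric.eball_subset_eball h.r_le hmem)
  simp only [binomialSeries_apply, List.ofFn_const, List.prod_replicate, smul_eq_mul, zero_add] at h1 h2
  exact ⟨h2, h1⟩

theorem coeff_pow_nonneg {Q : PowerSeries ℝ} (hQ : ∀ n, 0 ≤ Q.coeff n) (l n : ℕ) :
    0 ≤ (Q ^ l).coeff n := by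
  rw [PowerSeries.coeff_pow]
  exact sum_nonneg fun _ _ => prod_nonneg fun _ _ => hQ _

theorem abs_tsum_coeff_mul_pow_le {Q : PowerSeries ℝ} (hQ : ∀ n, 0 ≤ Q.coeff n) {x : ℝ}
    (hs : Summable fun n => Q.coeff n * |x| ^ n) :
    |∑' n, Q.coeff n * x ^ n| ≤ ∑' n, Q.coeff n * |x| ^ n := by
  have h : ∀ n, ‖Q.coeff n * x ^ n‖ = Q.coeff n * |x| ^ n := fun n => by
    rw [norm_mul, norm_pow, Real.norm_of_nonneg (hQ n), Real.norm_eq_abs]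
  have h' : Summable fun n => ‖Q.coeff n * x ^ n‖ := by simpa only [h] using hs
  simpa only [h, Real.norm_eq_abs] using norm_tsum_le_tsum_norm h'

theorem hasSum_one_add_powerSeries_rpow (s : ℝ) {Q : PowerSeries ℝ} (h0 : Q.coeff 0 = 0)
    (hQ : ∀ n, 0 ≤ Q.coeff n) {x : ℝ} (hs : Summable fun n => Q.coeff n * |x| ^ n)
    (hlt : ∑' n, Q.coeff n * |x| ^ n < 1) :
    (Summable fun n => ‖x ^ n * ∑ l ∈ range (n + 1), Ring.choose s l * (Q ^ l).coeff n‖) ∧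
      HasSum (fun n => x ^ n * ∑ l ∈ range (n + 1), Ring.choose s l * (Q ^ l).coeff n)
        ((1 + ∑' n, Q.coeff n * x ^ n) ^ s) := by
  have hnorm : ∀ l n, ‖(Q ^ l).coeff n * x ^ n‖ = (Q ^ l).coeff n * |x| ^ n := fun l n => by
    rw [norm_mul, norm_pow, Real.norm_eq_abs, Real.norm_eq_abs,
      abs_of_nonneg (coeff_pow_nonneg hQ l n)]
  have hnorm1 : ∀ n, ‖Q.coeff n * x ^ n‖ = Q.coeff n * |x| ^ n := by simpa using hnorm 1
  have hs' : Summable fun n => ‖Q.coeff n * x ^ n‖ := by simpa only [hnorm1] using hs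
  have hsabs : Summable fun n => ‖Q.coeff n * |x| ^ n‖ := hs.norm
  have htsum0 : 0 ≤ ∑' n, Q.coeff n * |x| ^ n :=
    tsum_nonneg fun n => mul_nonneg (hQ n) (by positivity)
  have hv := (abs_tsum_coeff_mul_pow_le hQ hs).trans_lt hlt
  let F : ℕ × ℕ → ℝ := fun p => Ring.choose s p.1 * ((Q ^ p.1).coeff p.2 * x ^ p.2)
  have hF : Summable fun p => ‖F p‖ := by
    rw [summable_prod_of_nonneg fun _ => norm_nonneg _]
    have hrow : ∀ l, HasSum (fun n => ‖F (l, n)‖)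
        (‖Ring.choose s l‖ * (∑' n, Q.coeff n * |x| ^ n) ^ l) := fun l => by
      simp only [F, norm_mul (Ring.choose s _), hnorm]
      exact (hasSum_coeff_pow Q |x| hsabs l).2.mul_left _
    refine ⟨fun l => (hrow l).summable, ?_⟩
    simp only [fun l => (hrow l).tsum_eq]
    have := (hasSum_choose_mul_pow s (x := ∑' n, Q.coeff n * |x| ^ n)
      (by rwa [abs_of_nonneg htsum0])).1
    simpa only [norm_mul, norm_pow, Real.norm_of_nonneg htsum0] using this
  have hcol : ∀ n, HasSum (fun l => F (l, n))
      (x ^ n * ∑ l ∈ range (n + 1), Ring.choose s l * (Q ^ l).coeff n) := fun n => by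
    have : x ^ n * ∑ l ∈ range (n + 1), Ring.choose s l * (Q ^ l).coeff n =
        ∑ l ∈ range (n + 1), F (l, n) := by
      rw [mul_sum]
      exact sum_congr rfl fun l _ => by simp only [F]; ring
    rw [this]
    refine hasSum_sum_of_ne_finset_zero fun l hl => ?_
    have hX : PowerSeries.X ∣ Q := by
      rwa [PowerSeries.X_dvd_iff, ← PowerSeries.coeff_zero_eq_constantCoeff_apply]
    have := PowerSeries.X_pow_dvd_iff.1 (pow_dvd_pow_of_dvd hX l) n (by simpa using hl)
    simp [F, this]
  have hswap : Summable fun p : ℕ × ℕ => ‖F p.swap‖ := hF.prod_symm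
  constructor
  · refine Summable.of_nonneg_of_le (fun _ => norm_nonneg _) (fun n => ?_) hswap.prod
    rw [← (hcol n).tsum_eq]
    exact norm_tsum_le_tsum_norm (hswap.prod_factor n)
  · have h1 : HasSum F ((1 + ∑' n, Q.coeff n * x ^ n) ^ s) := by
      have := hF.of_norm.hasSum.prod_fiberwise fun l =>
        ((hasSum_coeff_pow Q x hs' l).2.mul_left (Ring.choose s l))
      rw [← this.unique (hasSum_choose_mul_pow s hv).2]
      exact hF.of_norm.hasSum
    have h2 : HasSum (fun p : ℕ × ℕ => F p.swap) ((1 + ∑' n, Q.coeff n * x ^ n) ^ s) :=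
      (Equiv.prodComm ℕ ℕ).hasSum_iff.2 h1
    exact h2.prod_fiberwise hcol

theorem hasSum_exp_sub_sum_div (m : ℕ) {z : ℝ} (hz : z ≠ 0) :
    HasSum (fun n => (m.factorial : ℝ) / (m + n).factorial * z ^ n)
      ((Real.exp z - ∑ k ∈ range m, z ^ k / (k.factorial : ℝ)) / (z ^ m / m.factorial)) := by
  have h : HasSum (fun n => z ^ n / (n.factorial : ℝ)) (Real.exp z) := by
    rw [Real.exp_eq_exp_ℝ]
    exact NormedSpace.expSeries_div_hasSum_exp z
  have h1 := ((hasSum_nat_add_iff' m).2 h).div_const (z ^ m / (m.factorial : ℝ))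
  refine h1.congr_fun fun n => ?_
  rw [add_comm n m, pow_add]
  have : (m.factorial : ℝ) ≠ 0 := by positivity
  field_simp

theorem stmt_13 (t : ℝ) (m : ℕ) (hm : 0 < m)
    (C : ℕ → ℕ → ℝ)
    (hC : ∀ n k, C n k = (Nat.factorial n : ℝ) * (Nat.factorial m : ℝ) ^ k *
      ∑ j ∈ Finset.Nat.antidiagonalTuple k n,
        ∏ i, (1 : ℝ) / (Nat.factorial (m + j i) : ℝ)) :
    ∃ r > (0 : ℝ), ∀ z : ℝ, 0 < |z| → |z| ≤ r →
      0 < (z ^ m / (Nat.factorial m : ℝ)) /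
          (Real.exp z - ∑ k ∈ Finset.range m, z ^ k / (Nat.factorial k : ℝ)) ∧
      Summable (fun n : ℕ => |z ^ n / (Nat.factorial n : ℝ) *
        ∑ k ∈ Finset.range (n + 1),
          genBinom (-t) k * genBinom ((n : ℝ) + t) (n - k) * C n k|) ∧
      ((z ^ m / (Nat.factorial m : ℝ)) /
          (Real.exp z - ∑ k ∈ Finset.range m, z ^ k / (Nat.factorial k : ℝ))) ^ t =
        ∑' n : ℕ, z ^ n / (Nat.factorial n : ℝ) *
          ∑ k ∈ Finset.range (n + 1),
            genBinom (-t) k * genBinom ((n : ℝ) + t) (n - k) * C n k := by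
  refine ⟨1 / 2, by norm_num, fun z hz0 hz => ?_⟩
  have hz' : z ≠ 0 := abs_pos.1 hz0
  set f : ℕ → ℝ := fun n => (m.factorial : ℝ) / (m + n).factorial with hf
  set P : PowerSeries ℝ := PowerSeries.mk f with hP
  have hf0 : f 0 = 1 := by simp [hf, Nat.factorial_ne_zero]
  have hfle : ∀ n, f n ≤ 1 / n.factorial := fun n => by
    have h : (m.factorial : ℝ) * n.factorial ≤ (m + n).factorial := by
      exact_mod_cast Nat.le_of_dvd (Nat.factorial_pos _)
        (Nat.factorial_mul_factorial_dvd_factorial_add m n)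
    rw [hf, div_le_div_iff₀ (by positivity) (by positivity)]
    simpa using h
  have hcoeff : ∀ n, (P - 1).coeff n = if n = 0 then 0 else f n := fun n => by
    rw [map_sub, PowerSeries.coeff_one, hP, PowerSeries.coeff_mk]
    split_ifs with h <;> simp [h, hf0]
  have hsum : ∀ {y a : ℝ}, HasSum (fun n => f n * y ^ n) a →
      HasSum (fun n => (P - 1).coeff n * y ^ n) (a - 1) := fun {y a} h => by
    refine (h.sub (hasSum_ite_eq 0 (1 : ℝ))).congr_fun fun n => ?_
    rw [hcoeff]
    split_ifs with h <;> simp [h, hf0]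
  have hgz := hsum (hasSum_exp_sub_sum_div m hz')
  have hga := hsum (hasSum_exp_sub_sum_div m hz0.ne')
  have hlt : ∑' n, (P - 1).coeff n * |z| ^ n < 1 := by
    rw [hga.tsum_eq, sub_lt_iff_lt_add]
    refine lt_of_le_of_lt (hasSum_le (fun n => ?_) (hasSum_exp_sub_sum_div m hz0.ne')
      (hasSum_exp_sub_sum_div 0 hz0.ne')) ?_
    · refine mul_le_mul_of_nonneg_right ?_ (by positivity)
      simpa using hfle n
    · have h1 := Real.exp_bound_div_one_sub_of_interval' (x := 1 / 2) (by norm_num) (by norm_num)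
      have h2 := Real.exp_le_exp.2 hz
      norm_num at h1 ⊢
      linarith
  have hnonneg : ∀ n, 0 ≤ (P - 1).coeff n := fun n => by
    rw [hcoeff]
    split_ifs <;> positivity
  have hmain := hasSum_one_add_powerSeries_rpow (-t) (by simp [hcoeff]) hnonneg hga.summable hlt
  have habs := (abs_tsum_coeff_mul_pow_le hnonneg hga.summable).trans_lt hlt
  have hterm : ∀ n : ℕ, z ^ n / (n.factorial : ℝ) * ∑ k ∈ range (n + 1),
      genBinom (-t) k * genBinom ((n : ℝ) + t) (n - k) * C n k =
      z ^ n * ∑ l ∈ range (n + 1), Ring.choose (-t) l * ((P - 1) ^ l).coeff n := fun n => by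
    rw [sum_choose_mul_coeff_sub_one_pow, sub_neg_eq_add, div_mul_eq_mul_div, mul_div_assoc,
      sum_div]
    congr 1
    refine sum_congr rfl fun k _ => ?_
    have : C n k = n.factorial * (P ^ k).coeff n := by
      rw [hC, hP, coeff_mk_pow, mul_assoc, mul_sum (a := (m.factorial : ℝ) ^ k)]
      congr 1
      refine sum_congr rfl fun j _ => ?_
      simp [hf, div_eq_mul_inv, prod_mul_distrib]
    rw [this, genBinom_eq_choose, genBinom_eq_choose]
    have : (n.factorial : ℝ) ≠ 0 := by positivity
    field_simp
  simp only [hterm]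
  rw [hgz.tsum_eq] at hmain habs
  have hpos : 0 < (Real.exp z - ∑ k ∈ range m, z ^ k / (k.factorial : ℝ)) /
      (z ^ m / m.factorial) := by linarith [(abs_lt.1 habs).1]
  rw [← inv_div (Real.exp z - _)]
  refine ⟨inv_pos.2 hpos, hmain.1, ?_⟩
  rw [hmain.2.tsum_eq, Real.inv_rpow hpos.le, ← Real.rpow_neg hpos.le]
  congr 1
  ring
end

section
/- For every real β with 0 ≤ β ≤ 1 and all n, m ∈ ℕ₀ with m ≤ n: (1/m!) · Σ_{k=0}^m C(m,k)(−1)^{m−k} · Σ_{j=0}^k C(k,j)·β^j·(1−β)^{k−j}·j^n = β^m · S(n,m). Probabilistically: if X_1, X_2, … are i.i.d. Bernoulli(β) random variables and S_k = X_1 + ⋯ + X_k, then (1/m!)·Σ_{k=0}^m C(m,k)(−1)^{m−k}·E[S_k^n] = β^m·S(n,m). -/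
open Real Finset

/-- Stirling numbers of the second kind (as real numbers):
`S(n,m) = (1/m!) ∑_{k=0}^m C(m,k) (−1)^{m−k} k^n`. -/
noncomputable def stirling2 (n m : ℕ) : ℝ :=
  (1 / (Nat.factorial m : ℝ)) *
    ∑ k ∈ Finset.range (m + 1),
      (Nat.choose m k : ℝ) * (-1 : ℝ) ^ (m - k) * (k : ℝ) ^ n

theorem sum_Ico_choose_mul_neg_one_pow_mul_choose_mul_one_sub_pow {R : Type*} [CommRing R]
    (x : R) {j m : ℕ} (hj : j ≤ m) :
    ∑ k ∈ Finset.Ico j (m + 1),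
        (m.choose k : R) * (-1) ^ (m - k) * ((k.choose j : R) * (1 - x) ^ (k - j)) =
      (m.choose j : R) * (-1) ^ (m - j) * x ^ (m - j) := by
  have key : ((-1) ^ (m - j) * x ^ (m - j) : R) = ((1 - x) + (-1)) ^ (m - j) := by
    rw [← mul_pow]
    ring
  rw [mul_assoc, key, add_pow, Finset.sum_Ico_eq_sum_range, Finset.mul_sum, Nat.sub_add_comm hj]
  refine Finset.sum_congr rfl fun i hi => ?_
  have hi' : j + i ≤ m := by
    have := Finset.mem_range.mp hi
    omega
  have hc : (m.choose (j + i) : R) * ((j + i).choose j : R) =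
      (m.choose j : R) * ((m - j).choose i : R) := by
    have := Nat.choose_mul (n := m) (k := j + i) (s := j) (Nat.le_add_right j i)
    rw [Nat.add_sub_cancel_left] at this
    rw [← Nat.cast_mul, this, Nat.cast_mul]
  rw [Nat.add_sub_cancel_left, Nat.sub_add_eq]
  linear_combination (-1) ^ (m - j - i) * (1 - x) ^ i * hc

/-- The `m`-th forward difference at `0` of the binomial (Bernstein) averages of `f` is `x ^ m`
times the `m`-th forward difference of `f` at `0`. -/
theorem sum_choose_mul_neg_one_pow_mul_binomial_average {R : Type*} [CommRing R]
    (x : R) (f : ℕ → R) (m : ℕ) :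
    ∑ k ∈ Finset.range (m + 1), (m.choose k : R) * (-1) ^ (m - k) *
        ∑ j ∈ Finset.range (k + 1), (k.choose j : R) * x ^ j * (1 - x) ^ (k - j) * f j =
      x ^ m * ∑ j ∈ Finset.range (m + 1), (m.choose j : R) * (-1) ^ (m - j) * f j := by
  simp_rw [Finset.mul_sum]
  rw [Finset.sum_comm' (t' := Finset.range (m + 1)) (s' := fun j => Finset.Ico j (m + 1))
    (by intro k j; simp only [Finset.mem_range, Finset.mem_Ico]; omega)]
  refine Finset.sum_congr rfl fun j hj => ?_
  have hj' : j ≤ m := Nat.lt_succ_iff.mp (Finset.mem_range.mp hj)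
  have hx : x ^ m = x ^ j * x ^ (m - j) := by rw [← pow_add, Nat.add_sub_cancel' hj']
  calc
    _ = x ^ j * f j * ∑ k ∈ Finset.Ico j (m + 1),
        (m.choose k : R) * (-1) ^ (m - k) * ((k.choose j : R) * (1 - x) ^ (k - j)) := by
      rw [Finset.mul_sum]
      exact Finset.sum_congr rfl fun k _ => by ring
    _ = _ := by
      rw [sum_Ico_choose_mul_neg_one_pow_mul_choose_mul_one_sub_pow x hj', hx]
      ring

theorem stmt_16 (β : ℝ) (hβ0 : 0 ≤ β) (hβ1 : β ≤ 1)
    (n m : ℕ) (hmn : m ≤ n) :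
    (1 / (Nat.factorial m : ℝ)) *
      ∑ k ∈ Finset.range (m + 1), (Nat.choose m k : ℝ) * (-1 : ℝ) ^ (m - k) *
        ∑ j ∈ Finset.range (k + 1),
          (Nat.choose k j : ℝ) * β ^ j * (1 - β) ^ (k - j) * (j : ℝ) ^ n =
    β ^ m * stirling2 n m := by
  rw [sum_choose_mul_neg_one_pow_mul_binomial_average β (fun j => (j : ℝ) ^ n) m, stirling2,
    mul_left_comm]
end
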